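/- For all β and γ with 2⁻²⁰ > β > 2²⁰γ > 0 the following holds for every prime p. Let A, B ⊆ Z_p and let I, J be intervals of Z_p with |A| + |B| ≤ (1−β)p and max(|A Δ I|, |B Δ J|) ≤ γ·min(|A|, |B|). Then there exist in Z_p two triples of consecutive intervals I₁, I₂, I₃ and J₁, J₂, J₃ with ⌊(β/8)p⌋ ≤ min(|I₁|, |I₃|, |J₁|, |J₃|) ≤ max(|I₁|, |I₃|, |J₁|, |J₃|) ≤ (β/4)p such that, setting Aᵢ = A ∩ Iᵢ and Bᵢ = B ∩ Jᵢ, we have |A₁| = |B₁|, |A₃| = |B₃|, max(|A Δ I₂|, |B Δ J₂|) ≤ 2¹⁰γ·min(|A|, |B|), and moreover for i ∈ {1, 3} and for any two arithmetic progressions P and Q in Z_p, max(|Aᵢ Δ P|, |Bᵢ Δ Q|) ≥ |Aᵢ|/2¹⁰ = |Bᵢ|/2¹⁰. -/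

import Mathlib

open Finset Pointwise

/-- The interval `{a, a+1, ..., a+n-1}` in `ZMod p`. -/
def zmodInterval (p : ℕ) (a : ZMod p) (n : ℕ) : Finset (ZMod p) :=
  (Finset.range n).image (fun i : ℕ => a + (i : ZMod p))

/-- The arithmetic progression `{a, a+d, ..., a+(ℓ-1)d}` in `ZMod p`. -/
def zmodAP (p : ℕ) (a d : ZMod p) (ℓ : ℕ) : Finset (ZMod p) :=
  (Finset.range ℓ).image (fun i : ℕ => a + (i : ZMod p) * d)

section helpers
variable {p : ℕ}

noncomputable def iv (p : ℕ) (a b : ℤ) : Finset (ZMod p) := (Finset.Ico a b).image (fun k : ℤ => (k : ZMod p))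

noncomputable def cnt (A : Finset (ZMod p)) (a b : ℤ) : ℤ :=
  (((Finset.Ico a b).filter (fun k : ℤ => (k : ZMod p) ∈ A)).card : ℤ)

lemma mem_iv {a b : ℤ} {z : ZMod p} : z ∈ iv p a b ↔ ∃ k : ℤ, a ≤ k ∧ k < b ∧ (k : ZMod p) = z := by
  simp [iv, and_assoc]

lemma cast_inj' {k l : ℤ} (h : (k : ZMod p) = (l : ZMod p)) (h1 : k - l < p) (h2 : l - k < p) :
    k = l := by
  have := (ZMod.intCast_eq_intCast_iff_dvd_sub k l p).1 h
  have h3 := Int.eq_zero_of_abs_lt_dvd this (by rw [abs_lt]; constructor <;> linarith)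
  linarith

lemma cnt_nonneg (A : Finset (ZMod p)) (a b : ℤ) : 0 ≤ cnt A a b := by simp [cnt]

lemma cnt_le (A : Finset (ZMod p)) {a b : ℤ} (h : a ≤ b) : cnt A a b ≤ b - a := by
  have := Finset.card_filter_le (Finset.Ico a b) (fun k : ℤ => (k : ZMod p) ∈ A)
  simp only [Int.card_Ico] at this
  unfold cnt; omega

lemma cnt_add (A : Finset (ZMod p)) {a b c : ℤ} (h : a ≤ b) (h' : b ≤ c) :
    cnt A a b + cnt A b c = cnt A a c := by
  unfold cnt
  rw [← Finset.Ico_union_Ico_eq_Ico h h', Finset.filter_union, Finset.card_union_of_disjoint]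
  · push_cast; rfl
  · exact Finset.disjoint_filter_filter (Finset.Ico_disjoint_Ico_consecutive a b c)

lemma cnt_self (A : Finset (ZMod p)) (a : ℤ) : cnt A a a = 0 := by simp [cnt]

lemma inter_iv_eq (A : Finset (ZMod p)) (a b : ℤ) :
    A ∩ iv p a b = ((Finset.Ico a b).filter (fun k : ℤ => (k : ZMod p) ∈ A)).image
      (fun k : ℤ => (k : ZMod p)) := by
  ext z
  simp only [Finset.mem_inter, mem_iv, Finset.mem_image, Finset.mem_filter, Finset.mem_Ico]
  constructor
  · rintro ⟨h, k, h1, h2, rfl⟩; exact ⟨k, ⟨⟨h1, h2⟩, h⟩, rfl⟩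
  · rintro ⟨k, ⟨⟨h1, h2⟩, h⟩, rfl⟩; exact ⟨h, k, h1, h2, rfl⟩

lemma card_inter_iv (A : Finset (ZMod p)) {a b : ℤ} (h : b ≤ a + p) :
    ((A ∩ iv p a b).card : ℤ) = cnt A a b := by
  rw [inter_iv_eq, Finset.card_image_of_injOn]
  · rfl
  · intro k hk l hl hkl
    simp at hk hl
    exact cast_inj' hkl (by omega) (by omega)

lemma card_iv {a b : ℤ} (h0 : a ≤ b) (h : b ≤ a + p) : ((iv p a b).card : ℤ) = b - a := by
  unfold iv
  rw [Finset.card_image_of_injOn]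
  · simp; omega
  · intro k hk l hl hkl
    simp at hk hl
    exact cast_inj' hkl (by omega) (by omega)

lemma zmodInterval_eq (a : ℤ) (n : ℕ) : zmodInterval p (a : ZMod p) n = iv p a (a + n) := by
  ext z
  simp only [zmodInterval, mem_iv, Finset.mem_image, Finset.mem_range]
  constructor
  · rintro ⟨i, hi, rfl⟩; exact ⟨a + i, by omega, by omega, by push_cast; rfl⟩
  · rintro ⟨k, h1, h2, rfl⟩
    refine ⟨(k - a).toNat, by omega, ?_⟩
    have : ((k - a).toNat : ℤ) = k - a := by omega
    rw [← Int.cast_natCast (R := ZMod p), this]; push_cast; ring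

lemma disjoint_iv {a b c d : ℤ} (h1 : b ≤ c) (h : d ≤ a + p) : Disjoint (iv p a b) (iv p c d) := by
  rw [Finset.disjoint_left]
  intro z hz hz'
  obtain ⟨k, h2, h3, rfl⟩ := mem_iv.1 hz
  obtain ⟨l, h4, h5, h6⟩ := mem_iv.1 hz'
  have := cast_inj' h6 (by omega) (by omega)
  omega

lemma card_symmDiff' (A C : Finset (ZMod p)) :
    ((symmDiff A C).card : ℤ) = A.card + C.card - 2 * (A ∩ C).card := by
  have h1 : (symmDiff A C).card = (A \ C).card + (C \ A).card := by
    rw [symmDiff_def, Finset.sup_eq_union, Finset.card_union_of_disjoint]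
    exact disjoint_sdiff_sdiff
  have h2 := Finset.card_sdiff_add_card_inter A C
  have h3 := Finset.card_sdiff_add_card_inter C A
  rw [Finset.inter_comm C A] at h3
  omega

/-- optimal interval -/
lemma opt [NeZero p] (A : Finset (ZMod p)) (aI : ZMod p) (nI : ℕ) :
    ∃ u v : ℤ, u ≤ v ∧ v ≤ u + p ∧
      (A.card + (v - u) - 2 * cnt A u v ≤ 2 * (symmDiff A (zmodInterval p aI nI)).card) ∧
      (∀ m : ℤ, 0 ≤ m → m ≤ v - u → 2 * m ≤ 3 * cnt A u (u + m) ∧ 2 * m ≤ 3 * cnt A (v - m) v) ∧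
      (∀ m : ℤ, 0 ≤ m → v - u + m ≤ p →
        3 * cnt A (u - m) u ≤ 2 * m ∧ 3 * cnt A v (v + m) ≤ 2 * m) := by
  obtain ⟨a0, rfl⟩ := ZMod.intCast_surjective aI
  obtain ⟨n, hn, hI⟩ : ∃ n : ℕ, n ≤ p ∧ zmodInterval p (a0 : ZMod p) nI = iv p a0 (a0 + n) := by
    by_cases h : nI ≤ p
    · exact ⟨nI, h, zmodInterval_eq _ _⟩
    · refine ⟨p, le_rfl, ?_⟩
      have h2 : iv p a0 (a0 + p) = Finset.univ := by
        apply Finset.eq_univ_of_card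
        have := card_iv (p := p) (a := a0) (b := a0 + p) (by omega) le_rfl
        rw [ZMod.card]; omega
      rw [h2, Finset.eq_univ_iff_forall, zmodInterval_eq]
      intro z
      have : z ∈ iv p a0 (a0 + p) := by rw [h2]; simp
      obtain ⟨k, h1, h3, h4⟩ := mem_iv.1 this
      exact mem_iv.2 ⟨k, h1, by omega, h4⟩
  rw [hI]
  obtain ⟨w, ⟨u, v, huv, hvp, hw⟩, hmin⟩ := Int.exists_least_of_bdd
    (P := fun w => ∃ u v : ℤ, u ≤ v ∧ v ≤ u + p ∧ w = 2 * (v - u) - 3 * cnt A u v)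
    ⟨-p, by
      rintro z ⟨u, v, h1, h2, rfl⟩
      have := cnt_le A h1
      omega⟩ ⟨_, a0, a0, le_rfl, by omega, rfl⟩
  have hmin' : ∀ u' v' : ℤ, u' ≤ v' → v' ≤ u' + p →
      2 * (v - u) - 3 * cnt A u v ≤ 2 * (v' - u') - 3 * cnt A u' v' := by
    intro u' v' h1 h2
    rw [← hw]; exact hmin _ ⟨u', v', h1, h2, rfl⟩
  refine ⟨u, v, huv, hvp, ?_, ?_, ?_⟩
  · have h1 := hmin' a0 (a0 + n) (by omega) (by omega)
    have h2 := card_symmDiff' A (iv p a0 (a0 + n))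
    rw [card_inter_iv A (by omega), card_iv (by omega) (by omega)] at h2
    have h3 := cnt_le A huv
    have h4 : cnt A a0 (a0 + n) ≤ A.card := by
      rw [← card_inter_iv A (by omega)]
      exact_mod_cast Finset.card_le_card Finset.inter_subset_left
    omega
  · intro m hm hm'
    have h1 := hmin' (u + m) v (by omega) (by omega)
    have h2 := cnt_add A (show u ≤ u + m by omega) (show u + m ≤ v by omega)
    have h3 := hmin' u (v - m) (by omega) (by omega)
    have h4 := cnt_add A (show u ≤ v - m by omega) (show v - m ≤ v by omega)
    omega
  · intro m hm hm'
    have h1 := hmin' (u - m) v (by omega) (by omega)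
    have h2 := cnt_add A (show u - m ≤ u by omega) (show u ≤ v by omega)
    have h3 := hmin' u (v + m) (by omega) (by omega)
    have h4 := cnt_add A (show u ≤ v by omega) (show v ≤ v + m by omega)
    omega

lemma mem_AP {a d z : ZMod p} {ℓ : ℕ} : z ∈ zmodAP p a d ℓ ↔ ∃ i : ℕ, i < ℓ ∧ a + i * d = z := by
  simp [zmodAP]

/-- counting lemma: if shifting by `T` steps leaves `S`, then the progression is short. -/
lemma ap_short (S : Finset (ZMod p)) (a d : ZMod p) (ℓ T : ℕ)
    (hinj : Set.InjOn (fun i : ℕ => a + (i : ZMod p) * d) (Finset.range ℓ : Finset ℕ))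
    (hT : ∀ i : ℕ, a + (i : ZMod p) * d ∈ S → a + ((i + T : ℕ) : ZMod p) * d ∉ S) :
    ℓ ≤ T + 2 * (zmodAP p a d ℓ \ S).card := by
  classical
  have hbad : ((Finset.range ℓ).filter (fun i : ℕ => a + (i : ZMod p) * d ∉ S)).card
      ≤ (zmodAP p a d ℓ \ S).card := by
    apply Finset.card_le_card_of_injOn (fun i : ℕ => a + (i : ZMod p) * d)
    · intro i hi
      simp at hi
      simp only [Finset.coe_sdiff, Set.mem_sdiff, Finset.mem_coe, mem_AP]
      exact ⟨⟨i, hi.1, rfl⟩, hi.2⟩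
    · exact hinj.mono (by intro i hi; simp at hi ⊢; exact hi.1)
  have hgood : ((Finset.range (ℓ - T)).filter (fun i : ℕ => a + (i : ZMod p) * d ∈ S)).card
      ≤ ((Finset.range ℓ).filter (fun i : ℕ => a + (i : ZMod p) * d ∉ S)).card := by
    apply Finset.card_le_card_of_injOn (fun i : ℕ => i + T)
    · intro i hi
      simp only [Finset.coe_filter, Finset.mem_range, Set.mem_ofPred_eq] at hi ⊢
      exact ⟨by omega, hT i hi.2⟩
    · intro i _ j _ h; simpa using h
  have h3 : ((Finset.range (ℓ - T)).filter (fun i : ℕ => ¬ (a + (i : ZMod p) * d ∈ S))).card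
      ≤ ((Finset.range ℓ).filter (fun i : ℕ => a + (i : ZMod p) * d ∉ S)).card := by
    apply Finset.card_le_card
    apply Finset.filter_subset_filter
    apply Finset.range_subset_range.2; omega
  have h4 := Finset.card_filter_add_card_filter_not (s := Finset.range (ℓ - T))
    (fun i : ℕ => a + (i : ZMod p) * d ∈ S)
  rw [Finset.card_range] at h4
  omega

lemma sdf_le (S P : Finset (ZMod p)) : (S \ P).card ≤ (symmDiff S P).card :=
  Finset.card_le_card (by intro z; simp [Finset.mem_symmDiff]; tauto)
lemma sdff_le (S P : Finset (ZMod p)) : (P \ S).card ≤ (symmDiff S P).card :=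
  Finset.card_le_card (by intro z; simp [Finset.mem_symmDiff]; tauto)

lemma ap_pos (A : Finset (ZMod p)) (u N x : ℤ) (hx : 1 ≤ x)
    (hx' : cnt A (u - N) u = x) (hN : 0 ≤ N) (hMp : 100 * (N + 4 * x) ≤ p)
    (hr : 2 * (4 * x) ≤ 3 * cnt A u (u + 4 * x)) (hl : 3 * cnt A (u - x) u ≤ 2 * x)
    (a d : ZMod p) (ℓ : ℕ) (D : ℤ) (hd : d = (D : ZMod p)) (hD : 0 < D) (hDM : D < N + 4 * x)
    (hinj : Set.InjOn (fun i : ℕ => a + (i : ZMod p) * d) (Finset.range ℓ : Finset ℕ))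
    (he : 1024 * (symmDiff (A ∩ iv p (u - N) (u + 4 * x)) (zmodAP p a d ℓ)).card
      < (A ∩ iv p (u - N) (u + 4 * x)).card) : False := by
  have hxN : x ≤ N := by have := cnt_le A (show u - N ≤ u by omega); omega
  set S := A ∩ iv p (u - N) (u + 4 * x) with hS
  set P := zmodAP p a d ℓ with hP
  have hs : (S.card : ℤ) = x + cnt A u (u + 4 * x) := by
    rw [hS, card_inter_iv A (by omega), ← hx', cnt_add A (by omega) (by omega)]
  have hs2 := cnt_le A (show u ≤ u + 4 * x by omega)
  have e1 := sdf_le S P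
  have e2 := sdff_le S P
  have hcP : P.card ≤ ℓ := by
    have := Finset.card_image_le (s := Finset.range ℓ) (f := fun i : ℕ => a + (i : ZMod p) * d)
    simpa [hP, zmodAP] using this
  have hcS : S.card ≤ (S \ P).card + P.card := by
    have h1 := Finset.card_sdiff_add_card_inter S P
    have h2 := Finset.card_le_card (Finset.inter_subset_right (s₁ := S) (s₂ := P))
    omega
  obtain ⟨T, hT1, hT2⟩ : ∃ T : ℕ, N + 4 * x ≤ T * D ∧ T * D < 2 * (N + 4 * x) := by
    refine ⟨((N + 4 * x + D - 1) / D).toNat, ?_⟩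
    have h0 : 0 ≤ (N + 4 * x + D - 1) / D := Int.ediv_nonneg (by omega) (by omega)
    have h1 := Int.emod_add_mul_ediv (N + 4 * x + D - 1) D
    have h2 := Int.emod_nonneg (N + 4 * x + D - 1) (show D ≠ 0 by omega)
    have h3 := Int.emod_lt_of_pos (N + 4 * x + D - 1) hD
    rw [Int.toNat_of_nonneg h0]
    generalize (N + 4 * x + D - 1) / D = q at *
    rw [mul_comm q D]
    constructor <;> linarith
  have hshort := ap_short S a d ℓ T hinj (by
    intro i h1 h2
    rw [hS, Finset.mem_inter, mem_iv] at h1 h2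
    obtain ⟨_, k, k1, k2, k3⟩ := h1
    obtain ⟨_, l, l1, l2, l3⟩ := h2
    have : ((l : ℤ) : ZMod p) = ((k + T * D : ℤ) : ZMod p) := by
      push_cast; rw [l3, k3, hd]; push_cast; ring
    have := cast_inj' this (by omega) (by omega)
    omega)
  rw [← hP] at hshort
  have hℓT : ℓ ≤ 2 * T := by omega
  have hℓD : ℓ * D ≤ 4 * (N + 4 * x) := by
    have : (ℓ : ℤ) * D ≤ (2 * T) * D := by
      apply mul_le_mul_of_nonneg_right _ hD.le
      exact_mod_cast hℓT
    linarith
  have key : ∀ (i j : ℕ) (k l : ℤ), i < ℓ → j < ℓ → a + (i : ZMod p) * d = k →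
      a + (j : ZMod p) * d = l → |l - k| ≤ N + 4 * x → ((j : ℤ) - i) * D = l - k := by
    intro i j k l hi hj h1 h2 h3
    rw [abs_le] at h3
    have h4 : ((((j : ℤ) - i) * D : ℤ) : ZMod p) = ((l - k : ℤ) : ZMod p) := by
      push_cast; rw [← h1, ← h2, hd]; ring
    have h5 : ((j : ℤ) - i) * D ≤ ℓ * D := mul_le_mul_of_nonneg_right (by omega) hD.le
    have h6 : ((i : ℤ) - j) * D ≤ ℓ * D := mul_le_mul_of_nonneg_right (by omega) hD.le
    have h7 : ((i : ℤ) - j) * D = - (((j : ℤ) - i) * D) := by ring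
    exact cast_inj' h4 (by omega) (by omega)
  have hcount : ∀ c : ℤ, ∀ b : ℤ, u - N ≤ b → b ≤ c → c ≤ u + 4 * x →
      cnt A b c ≤ (S \ P).card + cnt P b c := by
    intro c b h1 h2 h3
    rw [← card_inter_iv A (by omega), ← card_inter_iv P (by omega)]
    have : A ∩ iv p b c ⊆ (S \ P) ∪ (P ∩ iv p b c) := by
      intro z hz
      rw [Finset.mem_inter] at hz
      by_cases hzP : z ∈ P
      · simp [hzP, hz.2]
      · obtain ⟨k, k1, k2, k3⟩ := mem_iv.1 hz.2
        have : z ∈ S := Finset.mem_inter.2 ⟨hz.1, mem_iv.2 ⟨k, by omega, by omega, k3⟩⟩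
        simp [hzP, this]
    have h4 := (Finset.card_le_card this).trans (Finset.card_union_le _ _)
    exact_mod_cast h4
  have hpos : ∀ b c : ℤ, 0 < cnt P b c → ∃ k : ℤ, b ≤ k ∧ k < c ∧ (k : ZMod p) ∈ P := by
    intro b c h
    unfold cnt at h
    have h' := Finset.card_pos.1 (by exact_mod_cast h)
    obtain ⟨k, hk⟩ := h'
    simp at hk
    exact ⟨k, hk.1.1, hk.1.2, hk.2⟩
  by_cases hD1 : D = 1
  · -- interval
    have c1 := hcount (u - x) (u - N) (by omega) (by omega) (by omega)
    have c2 := hcount (u + 4 * x) u (by omega) (by omega) (by omega)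
    have c3 := cnt_add A (show u - N ≤ u - x by omega) (show u - x ≤ u by omega)
    obtain ⟨k, k1, k2, k3⟩ := hpos (u - N) (u - x) (by omega)
    obtain ⟨l, l1, l2, l3⟩ := hpos u (u + 4 * x) (by omega)
    obtain ⟨i, hi, hi'⟩ := mem_AP.1 k3
    obtain ⟨j, hj, hj'⟩ := mem_AP.1 l3
    have hk := key i j k l hi hj hi' hj' (by rw [abs_le]; constructor <;> omega)
    rw [hD1, mul_one] at hk
    have hsub : iv p (u - x) u \ (A ∩ iv p (u - x) u) ⊆ P \ S := by
      intro z hz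
      rw [Finset.mem_sdiff] at hz
      obtain ⟨hz1, hz2⟩ := hz
      have hzA : z ∉ A := fun h => hz2 (Finset.mem_inter.2 ⟨h, hz1⟩)
      obtain ⟨m, m1, m2, rfl⟩ := mem_iv.1 hz1
      rw [Finset.mem_sdiff]
      refine ⟨mem_AP.2 ⟨(i + (m - k)).toNat, by omega, ?_⟩, fun h => hzA (Finset.mem_inter.1 h).1⟩
      rw [← Int.cast_natCast (R := ZMod p), Int.toNat_of_nonneg (by omega)]
      have : (m : ZMod p) = (k + (m - k) : ℤ) := by simp
      rw [this, Int.cast_add, Int.cast_add k, ← hi', hd, hD1]; push_cast; ring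
    have h1 := Finset.card_le_card hsub
    rw [Finset.card_sdiff_of_subset Finset.inter_subset_right] at h1
    have h2 := card_inter_iv A (show u ≤ u - x + p by omega)
    have h3 := card_iv (p := p) (show u - x ≤ u by omega) (show u ≤ u - x + p by omega)
    omega
  · have hno : ∀ k : ℤ, (k : ZMod p) ∈ P → ((k + 1 : ℤ) : ZMod p) ∉ P := by
      intro k h1 h2
      obtain ⟨i, hi, hi'⟩ := mem_AP.1 h1
      obtain ⟨j, hj, hj'⟩ := mem_AP.1 h2
      have hk := key i j k (k + 1) hi hj hi' hj' (by rw [abs_le]; constructor <;> omega)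
      have : D ∣ 1 := ⟨(j : ℤ) - i, by rw [mul_comm, hk]; ring⟩
      have := Int.le_of_dvd one_pos this
      omega
    have hhalf : ∀ m : ℕ, cnt P u (u + 2 * m) ≤ m := by
      intro m
      induction m with
      | zero => simp [cnt_self]
      | succ m ih =>
        have h1 := cnt_add P (show u ≤ u + 2 * m by omega) (show u + 2 * m ≤ u + 2 * m + 2 by omega)
        have h2 : cnt P (u + 2 * m) (u + 2 * m + 2) ≤ 1 := by
          unfold cnt
          have : ((Finset.Ico (u + 2 * m) (u + 2 * m + 2)).filter
              (fun k : ℤ => (k : ZMod p) ∈ P)).card ≤ 1 := by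
            rw [Finset.card_le_one]
            intro k hk l hl
            simp only [Finset.mem_filter, Finset.mem_Ico] at hk hl
            by_contra hne
            rcases lt_or_gt_of_ne hne with h | h
            · have : l = k + 1 := by omega
              subst this
              exact hno _ hk.2 hl.2
            · have : k = l + 1 := by omega
              subst this
              exact hno _ hl.2 hk.2
          exact_mod_cast this
        have h3 : u + 2 * ((m + 1 : ℕ) : ℤ) = u + 2 * m + 2 := by push_cast; ring
        rw [h3]; push_cast; omega
    have h1 := hhalf (2 * x).toNat
    have h2 : ((2 * x).toNat : ℤ) = 2 * x := by omega
    rw [h2, show u + 2 * (2 * x) = u + 4 * x by ring] at h1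
    have c2 := hcount (u + 4 * x) u (by omega) (by omega) (by omega)
    omega

lemma zmodAP_rev (a d : ZMod p) (ℓ : ℕ) :
    zmodAP p a d ℓ = zmodAP p (a + ((ℓ : ZMod p) - 1) * d) (-d) ℓ := by
  ext z
  simp only [mem_AP]
  constructor
  · rintro ⟨i, hi, rfl⟩
    refine ⟨ℓ - 1 - i, by omega, ?_⟩
    have : ((ℓ - 1 - i : ℕ) : ZMod p) = ℓ - 1 - i := by
      rw [Nat.cast_sub (by omega), Nat.cast_sub (by omega)]; simp
    rw [this]; ring
  · rintro ⟨i, hi, rfl⟩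
    refine ⟨ℓ - 1 - i, by omega, ?_⟩
    have : ((ℓ - 1 - i : ℕ) : ZMod p) = ℓ - 1 - i := by
      rw [Nat.cast_sub (by omega), Nat.cast_sub (by omega)]; simp
    rw [this]; ring

lemma ap_inj [Fact p.Prime] (a d : ZMod p) (hd : d ≠ 0) (ℓ : ℕ) (h : ℓ ≤ p) :
    Set.InjOn (fun i : ℕ => a + (i : ZMod p) * d) (Finset.range ℓ : Finset ℕ) := by
  intro i hi j hj hij
  simp at hi hj
  simp only [add_right_inj] at hij
  have := mul_right_cancel₀ hd hij
  have h2 : ((i : ℤ) : ZMod p) = ((j : ℤ) : ZMod p) := by exact_mod_cast this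
  have := cast_inj' h2 (by omega) (by omega)
  exact_mod_cast this

lemma ap_main [Fact p.Prime] (A : Finset (ZMod p)) (u N x : ℤ) (hx : 1 ≤ x)
    (hx' : cnt A (u - N) u = x) (hN : 0 ≤ N) (hMp : 100 * (N + 4 * x) ≤ p)
    (hr : 2 * (4 * x) ≤ 3 * cnt A u (u + 4 * x)) (hl : 3 * cnt A (u - x) u ≤ 2 * x)
    (a d : ZMod p) (ℓ : ℕ) :
    (A ∩ iv p (u - N) (u + 4 * x)).card ≤
      1024 * (symmDiff (A ∩ iv p (u - N) (u + 4 * x)) (zmodAP p a d ℓ)).card := by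
  by_contra he
  push Not at he
  have hs : ((A ∩ iv p (u - N) (u + 4 * x)).card : ℤ) = x + cnt A u (u + 4 * x) := by
    rw [card_inter_iv A (by omega), ← hx', cnt_add A (by omega) (by omega)]
  have hs2 := cnt_le A (show u ≤ u + 4 * x by omega)
  have e1 := sdf_le (A ∩ iv p (u - N) (u + 4 * x)) (zmodAP p a d ℓ)
  have e2 := sdff_le (A ∩ iv p (u - N) (u + 4 * x)) (zmodAP p a d ℓ)
  have hcS : ∀ S P : Finset (ZMod p), S.card ≤ (S \ P).card + P.card := by
    intro S P
    have h1 := Finset.card_sdiff_add_card_inter S P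
    have h2 := Finset.card_le_card (Finset.inter_subset_right (s₁ := S) (s₂ := P))
    omega
  have c1 := hcS (A ∩ iv p (u - N) (u + 4 * x)) (zmodAP p a d ℓ)
  have c2 := hcS (zmodAP p a d ℓ) (A ∩ iv p (u - N) (u + 4 * x))
  have hd0 : d ≠ 0 := by
    rintro rfl
    have : zmodAP p a 0 ℓ ⊆ {a} := by
      intro z hz
      obtain ⟨i, _, h⟩ := mem_AP.1 hz
      simp at h; simp [h]
    have := Finset.card_le_card this
    simp only [Finset.card_singleton] at this
    omega
  have hcard : ∀ ℓ' : ℕ, ℓ' ≤ p → (zmodAP p a d ℓ').card = ℓ' := by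
    intro ℓ' h
    unfold zmodAP
    rw [Finset.card_image_of_injOn (ap_inj a d hd0 ℓ' h), Finset.card_range]
  have hℓp : ℓ ≤ p := by
    by_contra h
    have h1 : zmodAP p a d p ⊆ zmodAP p a d ℓ := by
      intro z hz
      obtain ⟨i, hi, h'⟩ := mem_AP.1 hz
      exact mem_AP.2 ⟨i, by omega, h'⟩
    have := Finset.card_le_card h1
    rw [hcard p le_rfl] at this
    omega
  have hc := hcard ℓ hℓp
  have hex : ∃ i : ℕ, a + (i : ZMod p) * d ∈ A ∩ iv p (u - N) (u + 4 * x) ∧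
      a + ((i + 1 : ℕ) : ZMod p) * d ∈ A ∩ iv p (u - N) (u + 4 * x) := by
    by_contra hno
    push Not at hno
    have := ap_short (A ∩ iv p (u - N) (u + 4 * x)) a d ℓ 1 (ap_inj a d hd0 ℓ hℓp) hno
    omega
  obtain ⟨i, h1, h2⟩ := hex
  obtain ⟨k, k1, k2, k3⟩ := mem_iv.1 (Finset.mem_inter.1 h1).2
  obtain ⟨l, l1, l2, l3⟩ := mem_iv.1 (Finset.mem_inter.1 h2).2
  have hdD : d = ((l - k : ℤ) : ZMod p) := by
    push_cast; rw [l3, k3]; push_cast; ring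
  rcases lt_trichotomy (l - k) 0 with h | h | h
  · rw [zmodAP_rev] at he
    refine ap_pos A u N x hx hx' hN hMp hr hl _ (-d) ℓ (k - l) ?_ (by omega) (by omega)
      (ap_inj _ _ (neg_ne_zero.2 hd0) ℓ hℓp) he
    rw [hdD]; push_cast; ring
  · rw [h] at hdD; exact hd0 (by simpa using hdD)
  · exact ap_pos A u N x hx hx' hN hMp hr hl a d ℓ (l - k) hdD h (by omega)
      (ap_inj _ _ hd0 ℓ hℓp) he

lemma side_aux [Fact p.Prime] (A B : Finset (ZMod p)) (u u' N X : ℤ) (hN : 0 ≤ N)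
    (hMp : 100 * (N + 8 * X) ≤ p)
    (hA1 : ∀ m : ℤ, 0 ≤ m → m ≤ 8 * X → 2 * m ≤ 3 * cnt A u (u + m))
    (hA2 : ∀ m : ℤ, 0 ≤ m → m ≤ N → 3 * cnt A (u - m) u ≤ 2 * m)
    (hB1 : ∀ m : ℤ, 0 ≤ m → m ≤ 8 * X → 2 * m ≤ 3 * cnt B u' (u' + m))
    (hAX : cnt A (u - N) u ≤ X) (hBA : cnt B (u' - N) u' ≤ cnt A (u - N) u) :
    ∃ r r' : ℤ, 0 ≤ r ∧ r ≤ 8 * X ∧ 0 ≤ r' ∧ r' ≤ 8 * X ∧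
      (A ∩ iv p (u - N) (u + r)).card = (B ∩ iv p (u' - N) (u' + r')).card ∧
      ∀ (a d : ZMod p) (ℓ : ℕ), (A ∩ iv p (u - N) (u + r)).card ≤
        1024 * (symmDiff (A ∩ iv p (u - N) (u + r)) (zmodAP p a d ℓ)).card := by
  obtain ⟨x, hx⟩ : ∃ x, cnt A (u - N) u = x := ⟨_, rfl⟩
  have hx0 : 0 ≤ x := hx ▸ cnt_nonneg _ _ _
  have hy0 := cnt_nonneg B (u' - N) u'
  rcases hx0.eq_or_lt with h0 | h0
  · have h1 := card_inter_iv A (show u ≤ u - N + p by omega)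
    have h2 := card_inter_iv B (show u' ≤ u' - N + p by omega)
    refine ⟨0, 0, le_rfl, by omega, le_rfl, by omega, ?_, ?_⟩
    · rw [add_zero, add_zero]; omega
    · intro a d ℓ
      rw [add_zero]
      have : (A ∩ iv p (u - N) u).card = 0 := by omega
      rw [this]; omega
  · have hxN : x ≤ N := by have := cnt_le A (show u - N ≤ u by omega); omega
    have hs : ((A ∩ iv p (u - N) (u + 4 * x)).card : ℤ) = x + cnt A u (u + 4 * x) := by
      rw [card_inter_iv A (by omega), ← hx, cnt_add A (by omega) (by omega)]
    have hs2 := cnt_le A (show u ≤ u + 4 * x by omega)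
    have hs3 := cnt_nonneg A u (u + 4 * x)
    have hex : ∃ n : ℕ, ((A ∩ iv p (u - N) (u + 4 * x)).card : ℤ) ≤ cnt B (u' - N) (u' + n) := by
      refine ⟨(8 * x).toNat, ?_⟩
      rw [Int.toNat_of_nonneg (by omega), hs]
      have := hB1 (8 * x) (by omega) (by omega)
      have := cnt_add B (show u' - N ≤ u' by omega) (show u' ≤ u' + 8 * x by omega)
      omega
    classical
    have hle : Nat.find hex ≤ (8 * x).toNat := by
      apply Nat.find_min'
      rw [Int.toNat_of_nonneg (by omega), hs]
      have := hB1 (8 * x) (by omega) (by omega)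
      have := cnt_add B (show u' - N ≤ u' by omega) (show u' ≤ u' + 8 * x by omega)
      omega
    have hsp := Nat.find_spec hex
    have hmin := fun m => Nat.find_min hex (m := m)
    set n := Nat.find hex
    refine ⟨4 * x, n, by omega, by omega, by omega, by omega, ?_, ?_⟩
    · have h1 := card_inter_iv B (show u' + n ≤ u' - N + p by omega)
      have h2 : cnt B (u' - N) (u' + n) ≤ ((A ∩ iv p (u - N) (u + 4 * x)).card : ℤ) := by
        rcases Nat.eq_zero_or_pos n with hn | hn
        · rw [hn]; simp only [Nat.cast_zero, add_zero]; omega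
        · have h3 := hmin (n - 1) (by omega)
          have h4 : ((n - 1 : ℕ) : ℤ) = n - 1 := by omega
          rw [h4] at h3
          have h5 := cnt_add B (show u' - N ≤ u' + (n - 1) by omega)
            (show u' + ((n : ℤ) - 1) ≤ u' + n by omega)
          have h6 := cnt_le B (show u' + ((n : ℤ) - 1) ≤ u' + n by omega)
          omega
      omega
    · intro a d ℓ
      exact ap_main A u N x (by omega) hx hN (by omega) (hA1 _ (by omega) (by omega))
        (hA2 _ (by omega) (by omega)) a d ℓ

lemma side [Fact p.Prime] (A B : Finset (ZMod p)) (u u' N X : ℤ) (hN : 0 ≤ N)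
    (hMp : 100 * (N + 8 * X) ≤ p)
    (hA1 : ∀ m : ℤ, 0 ≤ m → m ≤ 8 * X → 2 * m ≤ 3 * cnt A u (u + m))
    (hA2 : ∀ m : ℤ, 0 ≤ m → m ≤ N → 3 * cnt A (u - m) u ≤ 2 * m)
    (hB1 : ∀ m : ℤ, 0 ≤ m → m ≤ 8 * X → 2 * m ≤ 3 * cnt B u' (u' + m))
    (hB2 : ∀ m : ℤ, 0 ≤ m → m ≤ N → 3 * cnt B (u' - m) u' ≤ 2 * m)
    (hAX : cnt A (u - N) u ≤ X) (hBX : cnt B (u' - N) u' ≤ X) :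
    ∃ r r' : ℤ, 0 ≤ r ∧ r ≤ 8 * X ∧ 0 ≤ r' ∧ r' ≤ 8 * X ∧
      (A ∩ iv p (u - N) (u + r)).card = (B ∩ iv p (u' - N) (u' + r')).card ∧
      ∀ (a d a' d' : ZMod p) (ℓ ℓ' : ℕ), (A ∩ iv p (u - N) (u + r)).card ≤
        1024 * max (symmDiff (A ∩ iv p (u - N) (u + r)) (zmodAP p a d ℓ)).card
          (symmDiff (B ∩ iv p (u' - N) (u' + r')) (zmodAP p a' d' ℓ')).card := by
  rcases le_total (cnt B (u' - N) u') (cnt A (u - N) u) with h | h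
  · obtain ⟨r, r', h1, h2, h3, h4, h5, h6⟩ := side_aux A B u u' N X hN hMp hA1 hA2 hB1 hAX h
    refine ⟨r, r', h1, h2, h3, h4, h5, fun a d a' d' ℓ ℓ' => ?_⟩
    exact (h6 a d ℓ).trans (Nat.mul_le_mul_left _ (le_max_left _ _))
  · obtain ⟨r, r', h1, h2, h3, h4, h5, h6⟩ := side_aux B A u' u N X hN hMp hB1 hB2 hA1 hBX h
    refine ⟨r', r, h3, h4, h1, h2, h5.symm, fun a d a' d' ℓ ℓ' => ?_⟩
    rw [← h5]
    exact (h6 a' d' ℓ').trans (Nat.mul_le_mul_left _ (le_max_right _ _))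

def ng (A : Finset (ZMod p)) : Finset (ZMod p) := A.map (Equiv.neg (ZMod p)).toEmbedding

lemma mem_ng {A : Finset (ZMod p)} {z : ZMod p} : z ∈ ng A ↔ -z ∈ A := by
  simp [ng, Finset.mem_map, neg_eq_iff_eq_neg]

lemma card_ng (A : Finset (ZMod p)) : (ng A).card = A.card := Finset.card_map _

lemma ng_iv (a b : ℤ) : iv p a b = ng (iv p (1 - b) (1 - a)) := by
  ext z
  rw [mem_ng, mem_iv, mem_iv]
  constructor
  · rintro ⟨k, h1, h2, rfl⟩; exact ⟨-k, by omega, by omega, by push_cast; rfl⟩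
  · rintro ⟨k, h1, h2, h⟩; exact ⟨-k, by omega, by omega, by push_cast; rw [h, neg_neg]⟩

lemma ng_inter (A C : Finset (ZMod p)) : ng A ∩ ng C = ng (A ∩ C) := by
  ext z; simp [mem_ng]

lemma ng_symmDiff (A C : Finset (ZMod p)) : symmDiff (ng A) (ng C) = ng (symmDiff A C) := by
  ext z; simp [mem_ng, Finset.mem_symmDiff]

lemma ng_AP (a d : ZMod p) (ℓ : ℕ) : zmodAP p (-a) (-d) ℓ = ng (zmodAP p a d ℓ) := by
  ext z
  rw [mem_ng, mem_AP, mem_AP]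
  constructor
  · rintro ⟨i, h, rfl⟩; exact ⟨i, h, by ring⟩
  · rintro ⟨i, h, h'⟩; exact ⟨i, h, by rw [← neg_neg z, ← h']; ring⟩

lemma cnt_ng (A : Finset (ZMod p)) (a b : ℤ) : cnt (ng A) a b = cnt A (1 - b) (1 - a) := by
  unfold cnt
  congr 1
  apply Finset.card_bij (fun k _ => -k)
  · intro k hk
    simp only [Finset.mem_filter, Finset.mem_Ico, mem_ng] at hk ⊢
    exact ⟨⟨by omega, by omega⟩, by push_cast; exact hk.2⟩
  · intro a _ b _ h; omega
  · intro k hk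
    simp only [Finset.mem_filter, Finset.mem_Ico] at hk
    refine ⟨-k, ?_, by omega⟩
    simp only [Finset.mem_filter, Finset.mem_Ico, mem_ng]
    exact ⟨⟨by omega, by omega⟩, by push_cast; simpa using hk.2⟩

lemma side_right [Fact p.Prime] (A B : Finset (ZMod p)) (v v' N X : ℤ) (hN : 0 ≤ N)
    (hMp : 100 * (N + 8 * X) ≤ p)
    (hA1 : ∀ m : ℤ, 0 ≤ m → m ≤ 8 * X → 2 * m ≤ 3 * cnt A (v - m) v)
    (hA2 : ∀ m : ℤ, 0 ≤ m → m ≤ N → 3 * cnt A v (v + m) ≤ 2 * m)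
    (hB1 : ∀ m : ℤ, 0 ≤ m → m ≤ 8 * X → 2 * m ≤ 3 * cnt B (v' - m) v')
    (hB2 : ∀ m : ℤ, 0 ≤ m → m ≤ N → 3 * cnt B v' (v' + m) ≤ 2 * m)
    (hAX : cnt A v (v + N) ≤ X) (hBX : cnt B v' (v' + N) ≤ X) :
    ∃ r r' : ℤ, 0 ≤ r ∧ r ≤ 8 * X ∧ 0 ≤ r' ∧ r' ≤ 8 * X ∧
      (A ∩ iv p (v - r) (v + N)).card = (B ∩ iv p (v' - r') (v' + N)).card ∧
      ∀ (a d a' d' : ZMod p) (ℓ ℓ' : ℕ), (A ∩ iv p (v - r) (v + N)).card ≤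
        1024 * max (symmDiff (A ∩ iv p (v - r) (v + N)) (zmodAP p a d ℓ)).card
          (symmDiff (B ∩ iv p (v' - r') (v' + N)) (zmodAP p a' d' ℓ')).card := by
  have e : ∀ v m : ℤ, 1 - (1 - v + m) = v - m := by intros; ring
  have e' : ∀ v m : ℤ, 1 - (1 - v - m) = v + m := by intros; ring
  have e'' : ∀ v : ℤ, 1 - (1 - v) = v := by intros; ring
  have := side (ng A) (ng B) (1 - v) (1 - v') N X hN hMp
  simp only [cnt_ng, e, e', e''] at this
  obtain ⟨r, r', h1, h2, h3, h4, h5, h6⟩ := this hA1 hA2 hB1 hB2 hAX hBX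
  have i1 : ∀ (A : Finset (ZMod p)) (v r : ℤ), ng A ∩ iv p (1 - v - N) (1 - v + r)
      = ng (A ∩ iv p (v - r) (v + N)) := by
    intro A v r
    rw [ng_iv, ng_inter, e, e']
  simp only [i1, card_ng] at h5 h6
  refine ⟨r, r', h1, h2, h3, h4, h5, fun a d a' d' ℓ ℓ' => ?_⟩
  have := h6 (-a) (-d) (-a') (-d') ℓ ℓ'
  simpa only [ng_AP, ng_symmDiff, card_ng] using this

end helpers

theorem stmt8 (β γ : ℝ) (hγ : 0 < γ) (hβγ : 2 ^ (20 : ℕ) * γ < β)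
    (hβ : β < ((2 : ℝ) ^ (20 : ℕ))⁻¹)
    (p : ℕ) (hp : p.Prime) (A B : Finset (ZMod p))
    (aI aJ : ZMod p) (nI nJ : ℕ)
    (hAB : (A.card : ℝ) + B.card ≤ (1 - β) * p)
    (hclose : ((max (symmDiff A (zmodInterval p aI nI)).card
        (symmDiff B (zmodInterval p aJ nJ)).card : ℕ) : ℝ) ≤ γ * (min A.card B.card : ℕ)) :
    ∃ (a b : ZMod p) (n₁ n₂ n₃ m₁ m₂ m₃ : ℕ),
      -- the two triples of consecutive intervals
      let I₁ := zmodInterval p a n₁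
      let I₂ := zmodInterval p (a + (n₁ : ZMod p)) n₂
      let I₃ := zmodInterval p (a + ((n₁ + n₂ : ℕ) : ZMod p)) n₃
      let J₁ := zmodInterval p b m₁
      let J₂ := zmodInterval p (b + (m₁ : ZMod p)) m₂
      let J₃ := zmodInterval p (b + ((m₁ + m₂ : ℕ) : ZMod p)) m₃
      let A₁ := A ∩ I₁; let A₂ := A ∩ I₂; let A₃ := A ∩ I₃
      let B₁ := B ∩ J₁; let B₂ := B ∩ J₂; let B₃ := B ∩ J₃
      (Disjoint I₁ I₂ ∧ Disjoint I₁ I₃ ∧ Disjoint I₂ I₃) ∧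
      (Disjoint J₁ J₂ ∧ Disjoint J₁ J₃ ∧ Disjoint J₂ J₃) ∧
      Nat.floor ((β / 8) * (p : ℝ)) ≤ min I₁.card (min I₃.card (min J₁.card J₃.card)) ∧
      ((max I₁.card (max I₃.card (max J₁.card J₃.card)) : ℕ) : ℝ) ≤ (β / 4) * p ∧
      A₁.card = B₁.card ∧ A₃.card = B₃.card ∧
      ((max (symmDiff A I₂).card (symmDiff B J₂).card : ℕ) : ℝ) ≤
        2 ^ (10 : ℕ) * γ * (min A.card B.card : ℕ) ∧
      (∀ (aP dP aQ dQ : ZMod p) (ℓP ℓQ : ℕ),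
        (A₁.card : ℝ) / 2 ^ (10 : ℕ) ≤
          ((max (symmDiff A₁ (zmodAP p aP dP ℓP)).card
            (symmDiff B₁ (zmodAP p aQ dQ ℓQ)).card : ℕ) : ℝ)) ∧
      (∀ (aP dP aQ dQ : ZMod p) (ℓP ℓQ : ℕ),
        (A₃.card : ℝ) / 2 ^ (10 : ℕ) ≤
          ((max (symmDiff A₃ (zmodAP p aP dP ℓP)).card
            (symmDiff B₃ (zmodAP p aQ dQ ℓQ)).card : ℕ) : ℝ)) := by
  haveI : Fact p.Prime := ⟨hp⟩
  haveI : NeZero p := ⟨hp.ne_zero⟩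
  obtain ⟨K, hK⟩ : ∃ K, max (symmDiff A (zmodInterval p aI nI)).card
        (symmDiff B (zmodInterval p aJ nJ)).card = K := ⟨_, rfl⟩
  obtain ⟨mn, hmn⟩ : ∃ mn, min A.card B.card = mn := ⟨_, rfl⟩
  rw [hK, hmn] at hclose
  obtain ⟨u, v, huv, hvp, hA0, hA1, hA2⟩ := opt A aI nI
  obtain ⟨u', v', huv', hvp', hB0, hB1, hB2⟩ := opt B aJ nJ
  have hKA : (symmDiff A (zmodInterval p aI nI)).card ≤ K := hK ▸ le_max_left _ _
  have hKB : (symmDiff B (zmodInterval p aJ nJ)).card ≤ K := hK ▸ le_max_right _ _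
  have hmA : mn ≤ A.card := hmn ▸ min_le_left _ _
  have hmB : mn ≤ B.card := hmn ▸ min_le_right _ _
  have hmA' : (mn : ℝ) ≤ A.card := by exact_mod_cast hmA
  have hmB' : (mn : ℝ) ≤ B.card := by exact_mod_cast hmB
  have hp0 : (0 : ℝ) < p := by exact_mod_cast hp.pos
  have hβ0 : 0 < β := by nlinarith
  norm_num at hβ hβγ
  have hmp : (mn : ℝ) ≤ p := by nlinarith
  have hmn0 : (0 : ℝ) ≤ mn := by positivity
  have hKβ : 1048576 * (K : ℝ) ≤ β * p := by nlinarith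
  have hβp : 1048576 * (β * p) ≤ p := by nlinarith
  have hKm : 1048576 * (K : ℝ) ≤ mn := by nlinarith
  have hKm' : 1048576 * K ≤ mn := by exact_mod_cast hKm
  obtain ⟨N, hNdef⟩ : ∃ N, Nat.floor ((β / 8) * (p : ℝ)) = N := ⟨_, rfl⟩
  have hN : (N : ℝ) ≤ (β / 8) * p := by rw [← hNdef]; exact Nat.floor_le (by positivity)
  have hNp : 100 * ((N : ℤ) + 8 * (2 * K)) ≤ p := by
    have : 100 * ((N : ℝ) + 8 * (2 * K)) ≤ p := by linarith
    exact_mod_cast this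
  have hAp : (A.card : ℤ) + 2 * K + 2 * N ≤ p := by
    have : (A.card : ℝ) + 2 * K + 2 * N ≤ p := by
      have : (0 : ℝ) ≤ B.card := by positivity
      linarith
    exact_mod_cast this
  have hBp : (B.card : ℤ) + 2 * K + 2 * N ≤ p := by
    have : (B.card : ℝ) + 2 * K + 2 * N ≤ p := by
      have : (0 : ℝ) ≤ A.card := by positivity
      linarith
    exact_mod_cast this
  -- generic facts
  have gen : ∀ (A : Finset (ZMod p)) (u v : ℤ), u ≤ v → v ≤ u + p → mn ≤ A.card →
      (A.card : ℤ) + 2 * K + 2 * N ≤ p → A.card + (v - u) - 2 * cnt A u v ≤ 2 * K →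
      v - u + 2 * N ≤ p ∧ 8 * (2 * K) + 8 * (2 * K) ≤ v - u ∧ cnt A (u - N) u ≤ 2 * K ∧
        cnt A v (v + N) ≤ 2 * K := by
    intro A u v h1 h2 h3 h4 h5
    have c1 := cnt_le A h1
    have c2 : cnt A u v ≤ A.card := by
      rw [← card_inter_iv A h2]; exact_mod_cast Finset.card_le_card Finset.inter_subset_left
    have c3 : v - u + 2 * N ≤ p := by omega
    have c4 : cnt A (u - N) (v + N) ≤ A.card := by
      rw [← card_inter_iv A (by omega)]
      exact_mod_cast Finset.card_le_card Finset.inter_subset_left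
    have c5 := cnt_add A (show u - N ≤ u by omega) (show u ≤ v + N by omega)
    have c6 := cnt_add A (show u ≤ v by omega) (show v ≤ v + N by omega)
    have c7 := cnt_nonneg A (u - N) u
    have c8 := cnt_nonneg A v (v + N)
    refine ⟨c3, by omega, by omega, by omega⟩
  obtain ⟨a1, a2, a3, a4⟩ := gen A u v huv hvp hmA hAp (by omega)
  obtain ⟨b1, b2, b3, b4⟩ := gen B u' v' huv' hvp' hmB hBp (by omega)
  obtain ⟨r, r', r1, r2, r3, r4, r5, r6⟩ := side A B u u' N (2 * K) (by omega) hNp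
    (fun m h h' => (hA1 m h (by omega)).1) (fun m h h' => (hA2 m h (by omega)).1)
    (fun m h h' => (hB1 m h (by omega)).1) (fun m h h' => (hB2 m h (by omega)).1) a3 b3
  obtain ⟨t, t', t1, t2, t3, t4, t5, t6⟩ := side_right A B v v' N (2 * K) (by omega) hNp
    (fun m h h' => (hA1 m h (by omega)).2) (fun m h h' => (hA2 m h (by omega)).2)
    (fun m h h' => (hB1 m h (by omega)).2) (fun m h h' => (hB2 m h (by omega)).2) a4 b4
  have trip : ∀ (u v r t : ℤ), 0 ≤ r → 0 ≤ t → r + t ≤ v - u →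
      zmodInterval p ((u - N : ℤ) : ZMod p) (N + r).toNat = iv p (u - N) (u + r) ∧
      zmodInterval p (((u - N : ℤ) : ZMod p) + ((N + r).toNat : ZMod p)) (v - t - u - r).toNat
        = iv p (u + r) (v - t) ∧
      zmodInterval p (((u - N : ℤ) : ZMod p) + (((N + r).toNat + (v - t - u - r).toNat : ℕ) : ZMod p))
        (t + N).toNat = iv p (v - t) (v + N) := by
    intro u v r t h1 h2 h3
    refine ⟨?_, ?_, ?_⟩
    · rw [zmodInterval_eq]; congr 1; omega
    · have : (((u - N : ℤ) : ZMod p) + ((N + r).toNat : ZMod p)) = ((u + r : ℤ) : ZMod p) := by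
        rw [← Int.cast_natCast (R := ZMod p), Int.toNat_of_nonneg (by omega)]; push_cast; ring
      rw [this, zmodInterval_eq]; congr 1; omega
    · have : (((u - N : ℤ) : ZMod p) + (((N + r).toNat + (v - t - u - r).toNat : ℕ) : ZMod p))
          = ((v - t : ℤ) : ZMod p) := by
        rw [← Int.cast_natCast (R := ZMod p), Nat.cast_add, Int.toNat_of_nonneg (by omega),
          Int.toNat_of_nonneg (by omega)]; push_cast; ring
      rw [this, zmodInterval_eq]; congr 1; omega
  have symm : ∀ (A : Finset (ZMod p)) (u v r t : ℤ), v - u + 2 * N ≤ p → 0 ≤ r → 0 ≤ t →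
      r + t ≤ v - u → r ≤ 8 * (2 * K) → t ≤ 8 * (2 * K) →
      A.card + (v - u) - 2 * cnt A u v ≤ 2 * K →
      (symmDiff A (iv p (u + r) (v - t))).card ≤ 34 * K := by
    intro A u v r t h0 h1 h2 h3 h4 h5 h6
    have := card_symmDiff' A (iv p (u + r) (v - t))
    rw [card_inter_iv A (by omega), card_iv (by omega) (by omega)] at this
    have c5 := cnt_add A (show u ≤ u + r by omega) (show u + r ≤ v by omega)
    have c6 := cnt_add A (show u + r ≤ v - t by omega) (show v - t ≤ v by omega)
    have c7 := cnt_le A (show u ≤ u + r by omega)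
    have c8 := cnt_le A (show v - t ≤ v by omega)
    omega
  have sA := symm A u v r t a1 r1 t1 (by omega) r2 t2 (by omega)
  have sB := symm B u' v' r' t' b1 r3 t3 (by omega) r4 t4 (by omega)
  obtain ⟨A1, A2, A3⟩ := trip u v r t r1 t1 (by omega)
  obtain ⟨B1, B2, B3⟩ := trip u' v' r' t' r3 t3 (by omega)
  refine ⟨((u - N : ℤ) : ZMod p), ((u' - N : ℤ) : ZMod p), (N + r).toNat, (v - t - u - r).toNat,
    (t + N).toNat, (N + r').toNat, (v' - t' - u' - r').toNat, (t' + N).toNat, ?_⟩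
  simp only [A1, A2, A3, B1, B2, B3]
  have q1 := card_iv (p := p) (show u - N ≤ u + r by omega) (by omega)
  have q2 := card_iv (p := p) (show v - t ≤ v + N by omega) (by omega)
  have q3 := card_iv (p := p) (show u' - N ≤ u' + r' by omega) (by omega)
  have q4 := card_iv (p := p) (show v' - t' ≤ v' + N by omega) (by omega)
  refine ⟨⟨disjoint_iv le_rfl (by omega), disjoint_iv (by omega) (by omega),
    disjoint_iv le_rfl (by omega)⟩, ⟨disjoint_iv le_rfl (by omega), disjoint_iv (by omega) (by omega),
    disjoint_iv le_rfl (by omega)⟩, ?_, ?_, r5, t5, ?_, ?_, ?_⟩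
  · rw [hNdef]
    simp only [le_min_iff]
    refine ⟨by omega, by omega, by omega, by omega⟩
  · have h : max (iv p (u - N) (u + r)).card (max (iv p (v - t) (v + N)).card
        (max (iv p (u' - N) (u' + r')).card (iv p (v' - t') (v' + N)).card)) ≤ N + 16 * K := by
      simp only [max_le_iff]
      refine ⟨by omega, by omega, by omega, by omega⟩
    have h' : ((max (iv p (u - N) (u + r)).card (max (iv p (v - t) (v + N)).card
        (max (iv p (u' - N) (u' + r')).card (iv p (v' - t') (v' + N)).card)) : ℕ) : ℝ)
          ≤ N + 16 * K := by exact_mod_cast h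
    linarith
  · have h := max_le sA sB
    have h' : ((max (symmDiff A (iv p (u + r) (v - t))).card
      (symmDiff B (iv p (u' + r') (v' - t'))).card : ℕ) : ℝ) ≤ 34 * K := by exact_mod_cast h
    rw [hmn]
    have hK0 : (0 : ℝ) ≤ K := by positivity
    refine h'.trans ?_
    norm_num
    nlinarith
  · intro aP dP aQ dQ ℓP ℓQ
    have h := r6 aP dP aQ dQ ℓP ℓQ
    rw [div_le_iff₀ (by positivity)]
    norm_num only
    rw [mul_comm]
    exact_mod_cast h
  · intro aP dP aQ dQ ℓP ℓQ
    have h := t6 aP dP aQ dQ ℓP ℓQ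
    rw [div_le_iff₀ (by positivity)]
    norm_num only
    rw [mul_comm]
    exact_mod_cast h
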